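/- For every alpha in [0,1), the class DIM_str^alpha = {X : Dim(X) = alpha} of sequences of constructive strong dimension exactly alpha is Wadge complete for boldface Pi^0_3, hence not a boldface Sigma^0_3 class. -/

import Mathlib

open Filter Topology

abbrev Cantor := ℕ → Bool

/-- The length-`n` prefix of an infinite binary sequence, as a list. -/
def pref (X : ℕ → Bool) (n : ℕ) : List Bool := (List.range n).map X

/-- A prefix-free machine: a partial computable map from programs (finite
binary strings) to strings, whose domain is an antichain under the prefix
relation. -/
def PFMachine (M : List Bool →. List Bool) : Prop :=
  Partrec M ∧ ∀ p q : List Bool, (M p).Dom → (M q).Dom → p <+: q → p = q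

/-- A universal prefix-free machine: a prefix-free machine simulating every
prefix-free machine with only a constant overhead in program length. -/
def UniversalPF (U : List Bool →. List Bool) : Prop :=
  PFMachine U ∧ ∀ M : List Bool →. List Bool, PFMachine M → ∃ c : ℕ,
    ∀ w p : List Bool, w ∈ M p → ∃ q : List Bool, w ∈ U q ∧ q.length ≤ p.length + c

/-- Prefix-free Kolmogorov complexity with respect to the machine `U`: the
length of a shortest program producing `w`. -/
noncomputable def K (U : List Bool →. List Bool) (w : List Bool) : ℕ :=
  sInf {n : ℕ | ∃ p : List Bool, w ∈ U p ∧ p.length = n}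

/-- `dimK U X = liminf_n K(X↾n)/n`, the (Kolmogorov characterization of the)
constructive dimension of the sequence `X`. -/
noncomputable def dimK (U : List Bool →. List Bool) (X : Cantor) : ℝ :=
  Filter.liminf (fun n : ℕ => (K U (pref X n) : ℝ) / n) Filter.atTop

/-- `DimK U X = limsup_n K(X↾n)/n`, the (Kolmogorov characterization of the)
constructive strong dimension of the sequence `X`. -/
noncomputable def DimK (U : List Bool →. List Bool) (X : Cantor) : ℝ :=
  Filter.limsup (fun n : ℕ => (K U (pref X n) : ℝ) / n) Filter.atTop

/-- A boldface Π⁰₃ subset of Cantor space: a countable intersection of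
countable unions of closed sets. -/
def BoldPi3 (A : Set Cantor) : Prop :=
  ∃ F : ℕ → ℕ → Set Cantor, (∀ n m, IsClosed (F n m)) ∧ A = ⋂ n, ⋃ m, F n m

/-- A boldface Σ⁰₃ subset of Cantor space: a countable union of countable
intersections of open sets. -/
def BoldSigma3 (A : Set Cantor) : Prop :=
  ∃ F : ℕ → ℕ → Set Cantor, (∀ n m, IsOpen (F n m)) ∧ A = ⋃ n, ⋂ m, F n m

/-- Generic prefix-free machine built from `U`: read a header, run `U` on the rest, and append. -/
theorem gen_machine (U : List Bool →. List Bool) (hU : UniversalPF U)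
    (guard : List Bool → Option Bool) (rest app : List Bool → List Bool)
    (hg : Computable guard) (hr : Computable rest) (ha : Computable app)
    (hpf : ∀ q q', (guard q).isSome → (guard q').isSome → q <+: q' →
      rest q <+: rest q' ∧ (rest q = rest q' → q = q')) :
    ∃ c : ℕ, ∀ q w, (guard q).isSome → w ∈ U (rest q) →
      ∃ p, (w ++ app q) ∈ U p ∧ p.length ≤ q.length + c := by
  let M : List Bool →. List Bool := fun q =>
    ((guard q : Option Bool) : Part Bool).bind (fun _ => (U (rest q)).map (fun w => w ++ app q))
  have hM : PFMachine M := by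
    constructor
    · refine Partrec.bind hg.ofOption ?_
      refine Partrec.map (f := fun x : List Bool × Bool => U (rest x.1))
        (g := fun (x : List Bool × Bool) (w : List Bool) => w ++ app x.1) ?_ ?_
      · exact hU.1.1.comp (hr.comp Computable.fst)
      · exact Computable.list_append.comp Computable.snd
          (ha.comp (Computable.fst.comp Computable.fst))
    · intro q q' h h' hqq
      have key : ∀ q, (M q).Dom → (guard q).isSome ∧ (U (rest q)).Dom := by
        intro q h
        obtain ⟨w, hw⟩ := Part.dom_iff_mem.1 h
        simp only [M, Part.mem_bind_iff, Part.mem_map_iff, Part.mem_coe] at hw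
        obtain ⟨b, hb, v, hv, -⟩ := hw
        exact ⟨by rw [Option.mem_def.1 hb]; rfl, Part.dom_iff_mem.2 ⟨v, hv⟩⟩
      obtain ⟨g1, u1⟩ := key q h
      obtain ⟨g2, u2⟩ := key q' h'
      obtain ⟨h1, h2⟩ := hpf q q' g1 g2 hqq
      exact h2 (hU.1.2 _ _ u1 u2 h1)
  obtain ⟨c, hc⟩ := hU.2 M hM
  refine ⟨c, fun q w hq hw => hc _ q ?_⟩
  simp only [M, Part.mem_bind_iff, Part.mem_map_iff, Part.mem_coe]
  obtain ⟨b, hb⟩ := Option.isSome_iff_exists.1 hq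
  exact ⟨b, hb, w, hw, rfl⟩

theorem bit_machine (U : List Bool →. List Bool) (hU : UniversalPF U) :
    ∃ c : ℕ, ∀ b p w, w ∈ U p → ∃ p', (w ++ [b]) ∈ U p' ∧ p'.length ≤ p.length + c := by
  obtain ⟨c, hc⟩ := gen_machine U hU List.head? List.tail (fun q => [q.headI])
    Primrec.list_head?.to_comp Primrec.list_tail.to_comp
    (Primrec.list_cons.comp Primrec.list_headI (Primrec.const [])).to_comp (by
      rintro (_ | ⟨a, q⟩) (_ | ⟨a', q'⟩) h h' hp <;> simp_all [List.cons_prefix_cons])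
  refine ⟨c + 1, fun b p w hw => ?_⟩
  obtain ⟨p', h1, h2⟩ := hc (b :: p) w rfl hw
  exact ⟨p', h1, by simp at h2; omega⟩

theorem zero_machine (U : List Bool →. List Bool) (hU : UniversalPF U) (L : ℕ) :
    ∃ c : ℕ, ∀ j p w, w ∈ U p →
      ∃ p', (w ++ List.replicate (L * j) false) ∈ U p' ∧ p'.length ≤ p.length + j + c := by
  have hid : Primrec (fun b : Bool => b) := Primrec.id
  obtain ⟨c, hc⟩ := gen_machine U hU (fun q => (q.dropWhile (fun b => b)).head?)
    (fun q => (q.dropWhile (fun b => b)).tail)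
    (fun q => (List.range (L * (q.takeWhile (fun b => b)).length)).map (fun _ => false))
    (Primrec.list_head?.comp (Primrec.list_dropWhile hid)).to_comp
    (Primrec.list_tail.comp (Primrec.list_dropWhile hid)).to_comp
    (Primrec.list_map (Primrec.list_range.comp (Primrec.nat_mul.comp (Primrec.const L)
      (Primrec.list_length.comp (Primrec.list_takeWhile hid)))) (Primrec.const false).to₂).to_comp
    (by
      intro q
      induction q with
      | nil => simp
      | cons a q ih =>
        rintro (_ | ⟨a', q'⟩) h h' hp
        · simp at hp
        · obtain ⟨rfl, hp2⟩ := List.cons_prefix_cons.1 hp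
          cases a
          · simp_all
          · simp only [List.dropWhile_cons, if_true] at h h' ⊢
            have := ih q' h h' hp2
            exact ⟨this.1, fun e => by rw [this.2 e]⟩)
  refine ⟨c + 1, fun j p w hw => ?_⟩
  have e1 : ∀ j : ℕ, (List.replicate j true ++ false :: p).dropWhile (fun b => b) = false :: p := by
    intro j; induction j with
    | zero => simp
    | succ j ih => simp [List.replicate_succ, ih]
  have e2 : ∀ j : ℕ, (List.replicate j true ++ false :: p).takeWhile (fun b => b)
      = List.replicate j true := by
    intro j; induction j with
    | zero => simp
    | succ j ih => simp [List.replicate_succ, ih]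
  obtain ⟨p', h1, h2⟩ := hc (List.replicate j true ++ false :: p) w (by simp only [e1]; rfl)
    (by simp only [e1]; exact hw)
  refine ⟨p', ?_, by simp at h2; omega⟩
  have : (List.range (L * j)).map (fun _ => false) = List.replicate (L * j) false := by
    simp
  simp only [e2, List.length_replicate] at h1
  rwa [this] at h1

theorem nil_prog (U : List Bool →. List Bool) (hU : UniversalPF U) : ∃ p, [] ∈ U p := by
  have hM : PFMachine (fun q : List Bool =>
      (((if q.isEmpty then some [] else none : Option (List Bool))) : Part (List Bool))) := by
    constructor
    · refine Computable.ofOption ?_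
      have : Primrec (fun q : List Bool => (if q.length = 0 then some ([] : List Bool) else none)) :=
        Primrec.ite (Primrec.eq.comp Primrec.list_length (Primrec.const 0))
          (Primrec.const _) (Primrec.const _)
      refine this.to_comp.of_eq fun q => ?_
      cases q <;> simp
    · intro p q hp hq h
      cases p <;> cases q <;> simp_all
  obtain ⟨c, hc⟩ := hU.2 _ hM
  obtain ⟨q, hq, -⟩ := hc [] [] (by simp)
  exact ⟨q, hq⟩

theorem all_prog (U : List Bool →. List Bool) (hU : UniversalPF U) (w : List Bool) :
    ∃ p, w ∈ U p := by
  induction w using List.reverseRecOn with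
  | nil => exact nil_prog U hU
  | append_singleton w b ih =>
    obtain ⟨p, hp⟩ := ih
    obtain ⟨c, hc⟩ := bit_machine U hU
    obtain ⟨p', h, -⟩ := hc b p w hp
    exact ⟨p', h⟩

theorem K_prog (U : List Bool →. List Bool) (hU : UniversalPF U) (w : List Bool) :
    ∃ p, w ∈ U p ∧ p.length = K U w := by
  obtain ⟨p, hp⟩ := all_prog U hU w
  exact Nat.sInf_mem (s := {n : ℕ | ∃ p : List Bool, w ∈ U p ∧ p.length = n}) ⟨_, p, hp, rfl⟩

theorem K_le (U : List Bool →. List Bool) {w p : List Bool} (h : w ∈ U p) : K U w ≤ p.length :=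
  Nat.sInf_le ⟨p, h, rfl⟩

/-- `K` increases by at most a constant per bit. -/
theorem K_bit (U : List Bool →. List Bool) (hU : UniversalPF U) :
    ∃ C : ℕ, ∀ w b, K U (w ++ [b]) ≤ K U w + C := by
  obtain ⟨c, hc⟩ := bit_machine U hU
  refine ⟨c, fun w b => ?_⟩
  obtain ⟨p, hp, hl⟩ := K_prog U hU w
  obtain ⟨p', h, h'⟩ := hc b p w hp
  have := K_le U h
  omega

theorem K_append (U : List Bool →. List Bool) {C : ℕ}
    (hC : ∀ w b, K U (w ++ [b]) ≤ K U w + C) (w v : List Bool) :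
    K U (w ++ v) ≤ K U w + C * v.length := by
  induction v using List.reverseRecOn with
  | nil => simp
  | append_singleton v b ih =>
    have := hC (w ++ v) b
    rw [← List.append_assoc, List.length_append, List.length_singleton, Nat.mul_add]
    omega

theorem K_zeros (U : List Bool →. List Bool) (hU : UniversalPF U) (L : ℕ) (hL : 0 < L) :
    ∃ D : ℕ, ∀ w j, (K U (w ++ List.replicate j false) : ℝ) ≤ K U w + (j : ℝ) / L + D := by
  obtain ⟨c, hc⟩ := zero_machine U hU L
  obtain ⟨C, hC⟩ := K_bit U hU
  refine ⟨c + C * L, fun w j => ?_⟩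
  obtain ⟨p, hp, hl⟩ := K_prog U hU w
  obtain ⟨p', h, h'⟩ := hc (j / L) p w hp
  have h1 := K_le U h
  have h2 := K_append U hC (w ++ List.replicate (L * (j / L)) false) (List.replicate (j % L) false)
  rw [List.append_assoc, List.replicate_append_replicate, Nat.div_add_mod, List.length_replicate] at h2
  have h3 : C * (j % L) ≤ C * L := Nat.mul_le_mul_left _ (Nat.mod_lt _ hL).le
  have h4 : K U (w ++ List.replicate j false) ≤ K U w + j / L + (c + C * L) := by omega
  have h5 : ((j / L : ℕ) : ℝ) ≤ (j : ℝ) / L := Nat.cast_div_le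
  have h6 : (K U (w ++ List.replicate j false) : ℝ) ≤ K U w + (j / L : ℕ) + (c + C * L : ℕ) := by
    exact_mod_cast h4
  push_cast at h6 ⊢
  linarith

/-- Counting: every string has an extension by `k` bits of complexity at least `k`. -/
theorem K_count (U : List Bool →. List Bool) (hU : UniversalPF U) (σ : List Bool) (k : ℕ) :
    ∃ τ : List Bool, τ.length = k ∧ k ≤ K U (σ ++ τ) := by
  rcases Nat.eq_zero_or_pos k with rfl | hk
  · exact ⟨[], rfl, Nat.zero_le _⟩
  by_contra! hcon
  choose P hP hPl using fun t : Fin k → Bool => K_prog U hU (σ ++ List.ofFn t)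
  have hlt : ∀ t, (P t).length < k := fun t => by
    rw [hPl]; exact hcon _ (by simp)
  let g : (Fin k → Bool) → (Fin k → Bool) := fun t i => (P t).getD i false
  have aux : ∀ t t', g t = g t' → (P t).length ≤ (P t').length → P t = P t' := by
    intro t t' h hle
    apply hU.1.2 _ _ (Part.dom_iff_mem.2 ⟨_, hP t⟩) (Part.dom_iff_mem.2 ⟨_, hP t'⟩)
    rw [List.prefix_iff_eq_take]
    apply List.ext_getElem
    · simp [hle]
    · intro i h1 h2
      have := congrFun h ⟨i, h1.trans (hlt t)⟩
      simp only [g] at this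
      rw [List.getD_eq_getElem _ _ h1, List.getD_eq_getElem _ _ (h1.trans_le hle)] at this
      simpa using this
  have inj : Function.Injective g := by
    intro t t' h
    have e : P t = P t' := by
      rcases le_total (P t).length (P t').length with hle | hle
      · exact aux t t' h hle
      · exact (aux t' t h.symm hle).symm
    have h1 := hP t
    rw [e] at h1
    have := Part.mem_unique h1 (hP t')
    exact List.ofFn_injective (List.append_cancel_left this)
  obtain ⟨t, ht⟩ := Finite.injective_iff_surjective.1 inj (fun _ => true)
  have := congrFun ht ⟨k - 1, by omega⟩
  simp only [g] at this
  rw [List.getD_eq_default _ _ (by have := hlt t; omega)] at this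
  simp at this

/-- One stage of the construction: steer the complexity ratio to `β`. -/
theorem stage (U : List Bool →. List Bool) (hU : UniversalPF U) (C : ℕ)
    (hC : ∀ w b, K U (w ++ [b]) ≤ K U w + C) (β : ℝ) (h0 : 0 < β) (h1 : β < 1) (σ : List Bool) :
    ∃ σ' : List Bool, σ <+: σ' ∧ σ.length < σ'.length ∧ β * σ'.length ≤ K U σ' ∧
      (K U σ' : ℝ) ≤ β * σ'.length + C ∧
      ∀ τ, σ <+: τ → τ <+: σ' → (K U τ : ℝ) ≤ β * τ.length + C ∨
        ∃ j, τ = σ ++ List.replicate j false := by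
  -- lowering phase
  obtain ⟨j, hj1, hj⟩ : ∃ j : ℕ, 1 ≤ j ∧
      (K U (σ ++ List.replicate j false) : ℝ) < β * ((σ.length : ℝ) + j) := by
    obtain ⟨L, hL⟩ := exists_nat_gt (2 / β)
    have hLpos : (0 : ℝ) < L := lt_trans (by positivity) hL
    obtain ⟨D, hD⟩ := K_zeros U hU L (by exact_mod_cast hLpos)
    obtain ⟨j, hj⟩ := exists_nat_gt (((K U σ : ℝ) + D) * 2 / β)
    have hjpos : (0 : ℝ) < j := lt_of_le_of_lt (by positivity) hj
    refine ⟨j, by exact_mod_cast hjpos, (hD σ j).trans_lt ?_⟩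
    rw [div_lt_iff₀ h0] at hj hL
    have : (j : ℝ) / L ≤ j * β / 2 := by
      rw [div_le_iff₀ hLpos]; nlinarith
    have : 0 ≤ β * σ.length := by positivity
    nlinarith
  set ρ := σ ++ List.replicate j false with hρ
  have hρl : (ρ.length : ℝ) = σ.length + j := by simp [hρ]
  -- raising phase
  obtain ⟨k, hk⟩ := exists_nat_gt (β * ρ.length / (1 - β))
  rw [div_lt_iff₀ (by linarith)] at hk
  obtain ⟨τ, hτl, hτ⟩ := K_count U hU ρ k
  have hex : ∃ i, β * ((ρ.length : ℝ) + i) ≤ K U (ρ ++ τ.take i) ∧ i ≤ k := by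
    refine ⟨k, ?_, le_rfl⟩
    rw [← hτl, List.take_length, hτl]
    have : (k : ℝ) ≤ K U (ρ ++ τ) := by exact_mod_cast hτ
    nlinarith
  classical
  obtain ⟨hi, hik⟩ := Nat.find_spec hex
  have hmin := fun m => @Nat.find_min _ _ hex m
  set i := Nat.find hex with hidef
  have hi0 : i ≠ 0 := by
    intro h
    rw [h] at hi
    simp only [List.take_zero, List.append_nil, Nat.cast_zero, add_zero] at hi
    rw [hρl] at hi
    linarith
  have hlen : ∀ m ≤ k, (ρ ++ τ.take m).length = ρ.length + m := by
    intro m hm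
    rw [List.length_append, List.length_take, hτl, min_eq_left hm]
  have hlow : ∀ m < i, (K U (ρ ++ τ.take m) : ℝ) < β * ((ρ.length : ℝ) + m) := by
    intro m hm
    have := hmin m hm
    by_contra! hcon
    exact this ⟨hcon, by omega⟩
  have hup : (K U (ρ ++ τ.take i) : ℝ) ≤ β * ((ρ.length : ℝ) + i) + C := by
    obtain ⟨m, hm⟩ := Nat.exists_eq_succ_of_ne_zero hi0
    have h2 := hlow m (by omega)
    have h3 : m < τ.length := by omega
    have h4 := hC (ρ ++ τ.take m) τ[m]
    rw [List.append_assoc, ← List.take_succ_eq_append_getElem h3] at h4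
    rw [hm]
    have h5 : (K U (ρ ++ τ.take (m+1)) : ℝ) ≤ K U (ρ ++ τ.take m) + C := by exact_mod_cast h4
    push_cast
    simp only [Nat.succ_eq_add_one]
    nlinarith
  have hσρ : σ <+: ρ := List.prefix_append _ _
  refine ⟨ρ ++ τ.take i, hσρ.trans (List.prefix_append _ _), ?_, ?_, ?_, ?_⟩
  · rw [hlen i hik, hρ, List.length_append, List.length_replicate]; omega
  · rw [hlen i hik]; push_cast; exact hi
  · rw [hlen i hik]; push_cast; exact hup
  · intro t ht1 ht2
    rcases le_total t.length ρ.length with hle | hle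
    · right
      have h3 : t <+: ρ := List.prefix_of_prefix_length_le ht2 (List.prefix_append _ _) hle
      obtain ⟨r, rfl⟩ := ht1
      rw [hρ, List.prefix_append_right_inj] at h3
      refine ⟨r.length, ?_⟩
      rw [List.prefix_iff_eq_take, List.take_replicate] at h3
      have h6 : r.length ≤ j := by rw [h3]; simp
      rw [min_eq_left h6] at h3
      rw [← h3]
    · left
      have h3 : ρ <+: t := List.prefix_of_prefix_length_le (List.prefix_append _ _) ht2 hle
      obtain ⟨r, rfl⟩ := h3
      rw [List.prefix_append_right_inj, List.prefix_take_iff] at ht2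
      obtain ⟨hr, hri⟩ := ht2
      rw [List.prefix_iff_eq_take] at hr
      rw [List.length_append]
      push_cast
      rcases hri.lt_or_eq with hlt | heq
      · have := hlow _ hlt
        rw [← hr] at this
        have : (0:ℝ) ≤ C := by positivity
        linarith
      · rw [heq] at hr ⊢
        rw [hr]; exact hup

theorem K_linear (U : List Bool →. List Bool) {C : ℕ}
    (hC : ∀ w b, K U (w ++ [b]) ≤ K U w + C) (w : List Bool) :
    K U w ≤ K U [] + C * w.length := by
  simpa using K_append U hC [] w

theorem pref_length (X : ℕ → Bool) (n : ℕ) : (pref X n).length = n := by simp [pref]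

theorem ratio_bdd (U : List Bool →. List Bool) (hU : UniversalPF U) :
    ∃ B : ℝ, ∀ X n, (K U (pref X n) : ℝ) / n ≤ B := by
  obtain ⟨C, hC⟩ := K_bit U hU
  refine ⟨K U [] + C, fun X n => ?_⟩
  rcases Nat.eq_zero_or_pos n with rfl | hn
  · simp; positivity
  have h := K_linear U hC (pref X n)
  rw [pref_length] at h
  have h' : (K U (pref X n) : ℝ) ≤ K U [] + C * n := by exact_mod_cast h
  have hn' : (1 : ℝ) ≤ n := by exact_mod_cast hn
  rw [div_le_iff₀ (by positivity)]
  have : (0:ℝ) ≤ K U [] := by positivity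
  nlinarith

theorem limsup_char (u : ℕ → ℝ) (B : ℝ) (h0 : ∀ n, 0 ≤ u n) (hB : ∀ n, u n ≤ B) (α : ℝ) :
    limsup u atTop = α ↔ (∀ ε > 0, ∃ N, ∀ n ≥ N, u n ≤ α + ε) ∧
      (∀ ε > 0, ∀ N, ∃ n ≥ N, α - ε ≤ u n) := by
  have b1 : IsBoundedUnder (· ≤ ·) atTop u := isBoundedUnder_of ⟨B, hB⟩
  have b2 : IsCoboundedUnder (· ≤ ·) atTop u :=
    (isBoundedUnder_of ⟨0, h0⟩ : IsBoundedUnder (· ≥ ·) atTop u).isCoboundedUnder_le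
  constructor
  · rintro rfl
    constructor
    · intro ε hε
      obtain ⟨N, hN⟩ := eventually_atTop.1
        (eventually_lt_of_limsup_lt (lt_add_of_pos_right (limsup u atTop) hε) b1)
      exact ⟨N, fun n hn => (hN n hn).le⟩
    · intro ε hε N
      obtain ⟨n, hn, h⟩ := frequently_atTop.1
        (frequently_lt_of_lt_limsup b2 (sub_lt_self (limsup u atTop) hε)) N
      exact ⟨n, hn, h.le⟩
  · rintro ⟨h1, h2⟩
    apply le_antisymm
    · apply le_of_forall_pos_le_add
      intro ε hε
      exact limsup_le_of_le b2 (eventually_atTop.2 (h1 ε hε))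
    · apply le_of_forall_pos_sub_le
      intro ε hε
      exact le_limsup_of_frequently_le (frequently_atTop.2 (h2 ε hε)) b1

theorem Dim_char (U : List Bool →. List Bool) (hU : UniversalPF U) (X : Cantor) (α : ℝ) :
    DimK U X = α ↔ (∀ ε > 0, ∃ N : ℕ, ∀ n ≥ N, (K U (pref X n) : ℝ) / n ≤ α + ε) ∧
      (∀ ε > 0, ∀ N : ℕ, ∃ n ≥ N, α - ε ≤ (K U (pref X n) : ℝ) / n) := by
  obtain ⟨B, hB⟩ := ratio_bdd U hU
  exact limsup_char _ B (fun n => by positivity) (hB X) α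

theorem pref_lc (n : ℕ) : IsLocallyConstant (fun X : Cantor => pref X n) := by
  induction n with
  | zero => exact IsLocallyConstant.of_constant _ (fun _ _ => rfl)
  | succ n ih =>
    have h1 : IsLocallyConstant (fun X : Cantor => X n) :=
      (IsLocallyConstant.iff_continuous _).2 (continuous_apply n)
    have h2 := ih.comp₂ h1 (fun l b => l ++ [b])
    have e : (fun X : Cantor => pref X (n + 1)) = fun X => pref X n ++ [X n] := by
      funext X; simp [pref, List.range_succ]
    rw [e]; exact h2

theorem lc_clopen (n : ℕ) (P : List Bool → Prop) : IsClopen {X : Cantor | P (pref X n)} :=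
  ⟨⟨by simpa [Set.preimage, Set.compl_ofPred] using (pref_lc n) {l | ¬ P l}⟩, (pref_lc n) {l | P l}⟩

theorem BoldPi3_of_countable {ι : Type} [Countable ι] [Nonempty ι] (F : ι → ℕ → Set Cantor)
    (hF : ∀ i m, IsClosed (F i m)) : BoldPi3 (⋂ i, ⋃ m, F i m) := by
  obtain ⟨e, he⟩ := exists_surjective_nat ι
  exact ⟨fun n m => F (e n) m, fun n m => hF _ _, (he.iInter_comp (fun i => ⋃ m, F i m)).symm⟩

theorem Dim_Pi3 (U : List Bool →. List Bool) (hU : UniversalPF U) (α : ℝ) :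
    BoldPi3 {X : Cantor | DimK U X = α} := by
  let F : ℕ ⊕ (ℕ × ℕ) → ℕ → Set Cantor := fun i m => match i with
    | .inl k => ⋂ n : ℕ, {X | m ≤ n → (K U (pref X n) : ℝ) / n ≤ α + 1 / ((k : ℝ) + 1)}
    | .inr (k, N) => {X | N ≤ m ∧ α - 1 / ((k : ℝ) + 1) ≤ (K U (pref X m) : ℝ) / m}
  have hF : ∀ i m, IsClosed (F i m) := by
    rintro (k | ⟨k, N⟩) m
    · exact isClosed_iInter fun n =>
        (lc_clopen n (fun l => m ≤ n → (K U l : ℝ) / n ≤ α + 1 / ((k : ℝ) + 1))).1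
    · exact (lc_clopen m (fun l => N ≤ m ∧ α - 1 / ((k : ℝ) + 1) ≤ (K U l : ℝ) / m)).1
  convert BoldPi3_of_countable F hF using 1
  ext X
  rw [Set.mem_ofPred_eq, Dim_char U hU]
  simp only [Set.mem_iInter, Set.mem_iUnion, Sum.forall, Prod.forall, F, Set.mem_ofPred_eq]
  refine and_congr ⟨fun h k => ?_, fun h ε hε => ?_⟩ ⟨fun h k N => ?_, fun h ε hε N => ?_⟩
  · exact h _ (by positivity)
  · obtain ⟨k, hk⟩ := exists_nat_one_div_lt hε
    obtain ⟨N, hN⟩ := h k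
    exact ⟨N, fun n hn => (hN n hn).trans (by linarith)⟩
  · exact h _ (by positivity) N
  · obtain ⟨k, hk⟩ := exists_nat_one_div_lt hε
    obtain ⟨n, hn, h⟩ := h k N
    exact ⟨n, hn, by linarith⟩

/-- There is a boldface `Π⁰₃` set which is not `Σ⁰₃` (diagonalization). -/
theorem exists_Pi3_not_Sigma3 : ∃ A : Set Cantor, BoldPi3 A ∧ ¬ BoldSigma3 A := by
  let code : ℕ × ℕ × List Bool → ℕ := Encodable.encode
  let G : ℕ → ℕ → Set Cantor := fun n m =>
    {X | ∃ k, X (code (n, m, pref X k)) = true}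
  have hG : ∀ n m, IsOpen (G n m) := by
    intro n m
    have : G n m = ⋃ k, ⋃ l : List Bool, {X | pref X k = l} ∩ {X | X (code (n, m, l)) = true} := by
      ext X; simp [G]
    rw [this]
    refine isOpen_iUnion fun k => isOpen_iUnion fun l => (lc_clopen k (· = l)).2.inter ?_
    have hc : Continuous (fun X : Cantor => X (code (n, m, l))) := continuous_apply _
    exact hc.isOpen_preimage {true} (isOpen_discrete _)
  refine ⟨⋂ n, ⋃ m, (G n m)ᶜ, ⟨fun n m => (G n m)ᶜ, fun n m => (hG n m).isClosed_compl, rfl⟩, ?_⟩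
  rintro ⟨F, hF, h⟩
  classical
  let X : Cantor := fun c => match (Encodable.decode c : Option (ℕ × ℕ × List Bool)) with
    | none => false
    | some (n, m, l) => decide ({Z : Cantor | pref Z l.length = l} ⊆ F n m)
  have hX : ∀ n m l, X (code (n, m, l)) = true ↔ {Z : Cantor | pref Z l.length = l} ⊆ F n m := by
    intro n m l
    simp only [X, code, Encodable.encodek, decide_eq_true_eq]
  have key : ∀ n m, X ∈ G n m ↔ X ∈ F n m := by
    intro n m
    constructor
    · rintro ⟨k, hk⟩
      rw [hX] at hk
      exact hk (by simp [pref_length])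
    · intro hx
      by_contra hcon
      have : ∀ k, ∃ Z : Cantor, pref Z k = pref X k ∧ Z ∉ F n m := by
        intro k
        have h1 : ¬ (X (code (n, m, pref X k)) = true) := fun h => hcon ⟨k, h⟩
        rw [hX, pref_length, Set.not_subset] at h1
        exact h1
      choose Z hZ hZF using this
      have ht : Tendsto Z atTop (𝓝 X) := by
        rw [tendsto_pi_nhds]
        intro i
        apply tendsto_const_nhds.congr'
        filter_upwards [eventually_gt_atTop i] with k hk
        have := congrArg (fun l => l[i]?) (hZ k)
        simpa [pref, hk] using this.symm
      obtain ⟨k, hk⟩ := (ht.eventually ((hF n m).mem_nhds hx)).exists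
      exact hZF k hk
  have h' := Set.ext_iff.1 h X
  simp only [Set.mem_iInter, Set.mem_iUnion, Set.mem_compl_iff, key] at h'
  by_cases hx : ∃ n, ∀ m, X ∈ F n m
  · obtain ⟨n, hn⟩ := hx
    obtain ⟨m, hm⟩ := h'.2 ⟨n, hn⟩ n
    exact hm (hn m)
  · apply hx
    apply h'.1
    push Not at hx
    exact hx

/-- Current guess for the least `m` with `X ∈ F n m`, based on the prefix `l` of length `s`. -/
noncomputable def guess (F : ℕ → ℕ → Set Cantor) (n s : ℕ) (l : List Bool) : ℕ :=
  sInf {m | m = s ∨ ∃ Z ∈ F n m, pref Z s = l}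

/-- The least `n` (capped by `s`) whose guess changes at stage `s`. -/
noncomputable def chg (F : ℕ → ℕ → Set Cantor) (X : Cantor) (s : ℕ) : ℕ :=
  sInf {n | n = s ∨ guess F n (s + 1) (pref X (s + 1)) ≠ guess F n s (pref X s)}

theorem chg_lc (F : ℕ → ℕ → Set Cantor) (s : ℕ) : IsLocallyConstant (fun X => chg F X s) :=
  (pref_lc (s + 1)).comp₂ (pref_lc s)
    (fun l l' => sInf {n | n = s ∨ guess F n (s + 1) l ≠ guess F n s l'})

theorem pref_succ (X : Cantor) (n : ℕ) : pref X (n + 1) = pref X n ++ [X n] := by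
  simp [pref, List.range_succ]

theorem pref_prefix (X : Cantor) {m n : ℕ} (h : m ≤ n) : pref X m <+: pref X n := by
  induction n, h using Nat.le_induction with
  | base => exact List.prefix_rfl
  | succ n _ ih => rw [pref_succ]; exact ih.trans (List.prefix_append _ _)

theorem guess_mono (F : ℕ → ℕ → Set Cantor) (n : ℕ) (X : Cantor) :
    Monotone (fun s => guess F n s (pref X s)) := by
  apply monotone_nat_of_le_succ
  intro s
  have hm : guess F n (s + 1) (pref X (s + 1)) ∈
      {m | m = s + 1 ∨ ∃ Z ∈ F n m, pref Z (s + 1) = pref X (s + 1)} :=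
    Nat.sInf_mem ⟨s + 1, Or.inl rfl⟩
  rcases hm with hm | ⟨Z, hZ, hp⟩
  · rw [hm]
    exact (Nat.sInf_le (Or.inl rfl)).trans (Nat.le_succ s)
  · apply Nat.sInf_le
    right
    rw [pref_succ, pref_succ] at hp
    exact ⟨Z, hZ, (List.append_inj' hp rfl).1⟩

theorem chg_iff (F : ℕ → ℕ → Set Cantor) (hF : ∀ n m, IsClosed (F n m)) (X : Cantor) :
    X ∈ ⋂ n, ⋃ m, F n m ↔ ∀ n, ∀ᶠ s in atTop, n ≤ chg F X s := by
  simp only [Set.mem_iInter, Set.mem_iUnion]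
  constructor
  · intro h n
    have key : ∀ i, ∀ᶠ s in atTop, guess F i (s + 1) (pref X (s + 1)) = guess F i s (pref X s) := by
      intro i
      obtain ⟨m, hm⟩ := h i
      have hb : ∀ s, guess F i s (pref X s) ≤ m := fun s => Nat.sInf_le (Or.inr ⟨X, hm, rfl⟩)
      have hbd : BddAbove (Set.range (fun s => guess F i s (pref X s))) :=
        ⟨m, by rintro _ ⟨s, rfl⟩; exact hb s⟩
      obtain ⟨s0, hs0⟩ := Nat.sSup_mem (Set.range_nonempty _) hbd
      have heq : ∀ s ≥ s0, guess F i s (pref X s) = guess F i s0 (pref X s0) := by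
        intro s hs
        apply le_antisymm
        · have : guess F i s (pref X s) ≤ sSup (Set.range (fun s => guess F i s (pref X s))) :=
            le_csSup hbd ⟨s, rfl⟩
          rw [← hs0] at this
          exact this
        · exact guess_mono F i X hs
      filter_upwards [eventually_ge_atTop s0] with s hs
      rw [heq s hs, heq (s + 1) (by omega)]
    have hall := (eventually_all_finite (Set.finite_lt_nat n)).2 (fun i _ => key i)
    filter_upwards [hall, eventually_ge_atTop n] with s hs hns
    apply le_csInf ⟨s, Or.inl rfl⟩
    rintro i (rfl | hi)
    · exact hns
    · by_contra! hlt
      exact hi (hs i hlt)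
  · intro h n
    obtain ⟨S, hS⟩ := eventually_atTop.1 (h (n + 1))
    have hc : ∀ s ≥ S, guess F n (s + 1) (pref X (s + 1)) = guess F n s (pref X s) := by
      intro s hs
      by_contra hne
      have h1 : chg F X s ≤ n := Nat.sInf_le (Or.inr hne)
      have := hS s hs
      omega
    have hconst : ∀ s ≥ S, guess F n s (pref X s) = guess F n S (pref X S) := by
      intro s hs
      induction s, hs using Nat.le_induction with
      | base => rfl
      | succ s hs ih => rw [hc s hs, ih]
    set m := guess F n S (pref X S) with hm
    refine ⟨m, ?_⟩
    have hZ : ∀ s, ∃ Z : Cantor, S + m + 1 ≤ s → Z ∈ F n m ∧ pref Z s = pref X s := by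
      intro s
      by_cases hs : S + m + 1 ≤ s
      · have h1 : guess F n s (pref X s) ∈ {m | m = s ∨ ∃ Z ∈ F n m, pref Z s = pref X s} :=
          Nat.sInf_mem ⟨s, Or.inl rfl⟩
        rw [hconst s (by omega)] at h1
        rcases h1 with h1 | ⟨Z, hZ, hp⟩
        · omega
        · exact ⟨Z, fun _ => ⟨hZ, hp⟩⟩
      · exact ⟨X, fun h => absurd h hs⟩
    choose Z hZ using hZ
    have ht : Tendsto Z atTop (𝓝 X) := by
      rw [tendsto_pi_nhds]
      intro i
      apply tendsto_const_nhds.congr'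
      filter_upwards [eventually_gt_atTop i, eventually_ge_atTop (S + m + 1)] with k hk hk2
      have := congrArg (fun l => l[i]?) (hZ k hk2).2
      simpa [pref, hk] using this.symm
    refine (hF n m).mem_of_tendsto ht ?_
    filter_upwards [eventually_ge_atTop (S + m + 1)] with k hk
    exact (hZ k hk).1

theorem hardness (U : List Bool →. List Bool) (hU : UniversalPF U) (α : ℝ)
    (hα : α ∈ Set.Ico (0:ℝ) 1) (A : Set Cantor) (hA : BoldPi3 A) :
    ∃ f : Cantor → Cantor, Continuous f ∧ A = f ⁻¹' {X : Cantor | DimK U X = α} := by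
  obtain ⟨F, hF, rfl⟩ := hA
  obtain ⟨hα0, hα1⟩ := hα
  obtain ⟨C, hC⟩ := K_bit U hU
  let β : ℕ → ℝ := fun a => α + (1 - α) / ((a : ℝ) + 2)
  have hβα : ∀ a, α < β a := fun a => by
    have : 0 < (1 - α) / ((a : ℝ) + 2) := div_pos (by linarith) (by positivity)
    simp only [β]; linarith
  have hβ0 : ∀ a, 0 < β a := fun a => hα0.trans_lt (hβα a)
  have hβ1 : ∀ a, β a < 1 := fun a => by
    have : (1 - α) / ((a : ℝ) + 2) < 1 - α := by
      apply div_lt_self (by linarith)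
      have : (0:ℝ) ≤ a := by positivity
      linarith
    simp only [β]; linarith
  have hβm : ∀ a b, a ≤ b → β b ≤ β a := fun a b hab => by
    simp only [β]
    have : (a : ℝ) ≤ b := by exact_mod_cast hab
    have : (1 - α) / ((b : ℝ) + 2) ≤ (1 - α) / ((a : ℝ) + 2) :=
      div_le_div_of_nonneg_left (by linarith) (by positivity) (by linarith)
    linarith
  choose nxt n1 n2 n3 n4 n5 using fun (a : ℕ) (σ : List Bool) =>
    stage U hU C hC (β a) (hβ0 a) (hβ1 a) σ
  let S : Cantor → ℕ → List Bool := fun X s =>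
    Nat.rec [] (fun s σ => nxt (chg F X s) σ) s
  have S1 : ∀ X s, S X (s + 1) = nxt (chg F X s) (S X s) := fun X s => rfl
  have Slc : ∀ s, IsLocallyConstant (fun X => S X s) := by
    intro s
    induction s with
    | zero => exact IsLocallyConstant.of_constant _ (fun _ _ => rfl)
    | succ s ih => exact (chg_lc F s).comp₂ ih nxt
  clear_value S
  let f : Cantor → Cantor := fun X n => (S X (n + 1)).getD n false
  have hlen : ∀ X s, (S X s).length < (S X (s + 1)).length := fun X s => by
    rw [S1]; exact n2 _ _
  have hmono : ∀ X, StrictMono (fun s => (S X s).length) := fun X => strictMono_nat_of_lt_succ (hlen X)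
  have hpre : ∀ X s t, s ≤ t → S X s <+: S X t := by
    intro X s t hst
    induction t, hst using Nat.le_induction with
    | base => exact List.prefix_rfl
    | succ t _ ih => rw [S1]; exact ih.trans (n1 _ _)
  have hpref : ∀ X s, pref (f X) (S X s).length = S X s := by
    intro X s
    apply List.ext_getElem
    · simp [pref]
    · intro i h1 h2
      have h3 : i < (S X (i + 1)).length := (Nat.lt_succ_self i).trans_le ((hmono X).le_apply)
      have h4 : (pref (f X) (S X s).length)[i] = (S X (i + 1))[i] := by
        simp only [pref, List.getElem_map, List.getElem_range, f]
        rw [List.getD_eq_getElem _ _ h3]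
      rw [h4]
      rcases le_total s (i + 1) with h | h
      · exact ((hpre X _ _ h).getElem h2).symm
      · exact (hpre X _ _ h).getElem h3
  refine ⟨f, ?_, ?_⟩
  · refine continuous_pi fun n => ?_
    exact ((Slc (n + 1)).comp (fun l => l.getD n false)).continuous
  ext X
  rw [chg_iff F hF, Set.mem_preimage, Set.mem_ofPred_eq, Dim_char U hU]
  -- the ratio at the end of a stage
  have hend : ∀ s, β (chg F X s) ≤
      (K U (pref (f X) (S X (s + 1)).length) : ℝ) / (S X (s + 1)).length := by
    intro s
    have hp : (0 : ℝ) < (S X (s + 1)).length := by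
      exact_mod_cast (Nat.zero_le _).trans_lt (hlen X s)
    rw [hpref, le_div_iff₀ hp]
    rw [S1]
    exact n3 _ _
  constructor
  · intro h
    constructor
    · intro ε hε
      obtain ⟨L, hL⟩ := exists_nat_gt (3 / ε)
      have hL0 : (0 : ℝ) < L := lt_trans (by positivity) hL
      obtain ⟨D, hD⟩ := K_zeros U hU L (by exact_mod_cast hL0)
      obtain ⟨a, ha⟩ := exists_nat_gt (3 / ε)
      obtain ⟨s0, hs0⟩ := eventually_atTop.1 (h a)
      have hβa : β a ≤ α + ε / 3 := by
        simp only [β]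
        have : (1 - α) / ((a : ℝ) + 2) ≤ ε / 3 := by
          rw [div_le_div_iff₀ (by positivity) (by norm_num)]
          rw [div_lt_iff₀ hε] at ha
          nlinarith
        linarith
      obtain ⟨N, hN⟩ := exists_nat_gt (((C : ℝ) + D) * 3 / ε)
      refine ⟨max N ((S X (s0 + 1)).length + 1), fun n hn => ?_⟩
      have hnN : N ≤ n := (le_max_left _ _).trans hn
      have hn1 : (S X (s0 + 1)).length + 1 ≤ n := (le_max_right _ _).trans hn
      have hn0 : (0 : ℝ) < n := by exact_mod_cast (by omega : 0 < n)
      -- find the stage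
      have hex : ∃ s, n < (S X s).length :=
        ⟨n + 1, (Nat.lt_succ_self n).trans_le ((hmono X).le_apply)⟩
      classical
      have hfs := Nat.find_spec hex
      have hfm := fun m => @Nat.find_min _ _ hex m
      generalize Nat.find hex = t at hfs hfm
      have ht : s0 + 1 < t := by
        by_contra! hcon
        have : (S X t).length ≤ (S X (s0 + 1)).length := (hmono X).monotone hcon
        omega
      obtain ⟨s, rfl⟩ : ∃ s, t = s + 2 := ⟨t - 2, by omega⟩
      have hle : (S X (s + 1)).length ≤ n := by
        have := hfm (s + 1) (by omega)
        omega
      have hτ1 : S X (s + 1) <+: pref (f X) n := by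
        have := pref_prefix (f X) hle
        rwa [hpref] at this
      have hτ2 : pref (f X) n <+: S X (s + 2) := by
        have := pref_prefix (f X) hfs.le
        rwa [hpref] at this
      have hb1 : β (chg F X (s + 1)) ≤ β a := hβm _ _ (hs0 _ (by omega))
      have hb2 : β (chg F X s) ≤ β a := hβm _ _ (hs0 _ (by omega))
      have hmain : (K U (pref (f X) n) : ℝ) ≤ β a * n + (n : ℝ) / L + (C + D) := by
        rw [S1] at hτ2
        rcases n5 _ _ _ hτ1 hτ2 with h1 | ⟨j, hj⟩
        · rw [pref_length] at h1
          have : (0 : ℝ) ≤ (n : ℝ) / L := by positivity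
          have : (0 : ℝ) ≤ D := by positivity
          nlinarith
        · have h2 := n4 (chg F X s) (S X s)
          rw [← S1] at h2
          have h3 := hD (S X (s + 1)) j
          rw [← hj] at h3
          have h4 : n = (S X (s + 1)).length + j := by
            have := congrArg List.length hj
            simpa [pref_length] using this
          have h5 : (n : ℝ) = (S X (s + 1)).length + j := by exact_mod_cast h4
          have h6 : (j : ℝ) / L ≤ (n : ℝ) / L := by
            apply div_le_div_of_nonneg_right _ hL0.le
            rw [h5]; linarith [(by positivity : (0:ℝ) ≤ ((S X (s + 1)).length : ℝ))]
          have h7 : β (chg F X s) * ((S X (s + 1)).length : ℝ) ≤ β a * n := by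
            apply mul_le_mul hb2 _ (by positivity) (hβ0 a).le
            rw [h5]; linarith [(by positivity : (0:ℝ) ≤ (j : ℝ))]
          linarith
      rw [div_le_iff₀ hn0]
      have e1 : (n : ℝ) / L ≤ ε / 3 * n := by
        rw [div_le_iff₀ hL0]
        rw [div_lt_iff₀ hε] at hL
        nlinarith
      have e2 : (C : ℝ) + D ≤ ε / 3 * n := by
        rw [div_lt_iff₀ hε] at hN
        have : (N : ℝ) ≤ n := by exact_mod_cast hnN
        nlinarith
      nlinarith
    · intro ε hε N
      refine ⟨(S X (N + 1)).length, (Nat.le_succ N).trans ((hmono X).le_apply), ?_⟩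
      have := hend N
      have := hβα (chg F X N)
      linarith
  · rintro ⟨h, -⟩ n
    have hd : 0 < (β n - α) / 2 := by linarith [hβα n]
    obtain ⟨N, hN⟩ := h _ hd
    filter_upwards [eventually_ge_atTop N] with s hs
    by_contra! hlt
    have h1 := hend s
    have h2 : N ≤ (S X (s + 1)).length :=
      (hs.trans (Nat.le_succ s)).trans ((hmono X).le_apply)
    have h3 := hN _ h2
    have h4 := hβm _ _ hlt.le
    linarith [hβα n]

/-- For every `α ∈ [0,1)`, the class `DIM_str^α = {X | Dim(X) = α}` of
sequences of constructive strong dimension exactly `α` is Wadge complete for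
boldface Π⁰₃, hence not a boldface Σ⁰₃ class. -/
theorem DIMstr_Wadge_complete_Pi03 (U : List Bool →. List Bool)
    (hU : UniversalPF U) (α : ℝ) (hα : α ∈ Set.Ico (0:ℝ) 1) :
    BoldPi3 {X : Cantor | DimK U X = α} ∧
    (∀ A : Set Cantor, BoldPi3 A → ∃ f : Cantor → Cantor,
        Continuous f ∧ A = f ⁻¹' {X : Cantor | DimK U X = α}) ∧
    ¬ BoldSigma3 {X : Cantor | DimK U X = α} := by 
  refine ⟨Dim_Pi3 U hU α, hardness U hU α hα, ?_⟩
  rintro ⟨G, hG, h⟩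
  obtain ⟨A, hA, hA'⟩ := exists_Pi3_not_Sigma3
  obtain ⟨f, hf, hfA⟩ := hardness U hU α hα A hA
  refine hA' ⟨fun n m => f ⁻¹' G n m, fun n m => (hG n m).preimage hf, ?_⟩
  rw [hfA, h]
  simp only [Set.preimage_iUnion, Set.preimage_iInter]
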